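/- Let F : [t0,T] × ℝ^{n1×⋯×nd} → ℝ^{n1×⋯×nd} be continuous and satisfy, in the Frobenius norm, ‖F(t,Y) − F(t,Ỹ)‖ ≤ L‖Y − Ỹ‖ and ‖F(t,Y)‖ ≤ B for all tensors Y, Ỹ and all t ∈ [t0,T]. Let A(t) solve Ȧ(t) = F(t,A(t)) with A(t0) of multilinear rank (r1,…,rd). Suppose there is ε ≥ 0 such that for every i = 1,…,d, every t ∈ [t0,T], and every tensor Y with rank(mat_i(Y)) = r_i in a neighborhood of A(t), F(t,Y) can be decomposed as F(t,Y) = M_i(t,Y) + R_i(t,Y) with M_i(t,Y) in the tangent space at Y of the set M_i = {Y : rank(mat_i(Y)) = r_i} and ‖R_i(t,Y)‖ ≤ ε; equivalently, ‖(I − P_i) mat_i(F(t,Y)) (I − Q_i)‖ ≤ ε, where P_i and Q_i are the orthogonal projections onto the column space and the row space of mat_i(Y). Let Y_n be the iterates of the nested Tucker integrator with step size h > 0 starting from Y_0 = A(t0) (a multilinear rank-(r1,…,rd) tensor), where all substep differential equations are solved exactly. Then ‖Y_n − A(t_n)‖ ≤ c1 h + c2 ε for all n with t_n = t0 + nh ≤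 T, where c1, c2 depend only on L, B, T − t0 and the dimension d; in particular they are independent of singular values of matricizations of the exact or approximate solution. -/

import Mathlib

open Matrix Set

namespace TuckerPaper

/-! ### Basic tensor formalism

A tensor of order `D` with dimensions `n : Fin D → ℕ` is a real-valued function on the
product index set `Idx n`.  `matr n i` is the `i`-mode matricization, `tenr n i` its
inverse (tensorization), `mlprod B` the multilinear (Tucker) product with the family of
matrices `B`, and `kronFam i B` the Kronecker product of the matrices `B j` over all
modes `j ≠ i`, indexed compatibly with the `i`-mode matricization. -/

variable {D : ℕ}

/-- Index set of a tensor with dimensions `n`. -/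
abbrev Idx (n : Fin D → ℕ) : Type := (j : Fin D) → Fin (n j)

/-- Real tensors with dimensions `n`. -/
abbrev Tensor (n : Fin D → ℕ) : Type := Idx n → ℝ

/-- Column index set of the `i`-mode matricization (all modes except `i`). -/
abbrev CIdx (n : Fin D → ℕ) (i : Fin D) : Type := (j : {j : Fin D // j ≠ i}) → Fin (n j.1)

/-- `i`-mode matricization of a tensor. -/
def matr (n : Fin D → ℕ) (i : Fin D) (X : Tensor n) : Matrix (Fin (n i)) (CIdx n i) ℝ :=
  fun k m => X (fun j => if h : j = i then Fin.cast (congrArg n h).symm k else m ⟨j, h⟩)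

/-- Inverse of the `i`-mode matricization (tensorization). -/
def tenr (n : Fin D → ℕ) (i : Fin D) (M : Matrix (Fin (n i)) (CIdx n i) ℝ) : Tensor n :=
  fun idx => M (idx i) (fun j => idx j.1)

/-- Multilinear (Tucker) product `X ×₁ B 1 ×₂ B 2 ⋯ ×_D B D`. -/
noncomputable def mlprod {n m : Fin D → ℕ} (B : ∀ j, Matrix (Fin (m j)) (Fin (n j)) ℝ)
    (X : Tensor n) : Tensor m :=
  fun idx => ∑ kk : Idx n, (∏ j, B j (idx j) (kk j)) * X kk

/-- Kronecker product of the family `B j` over all modes `j ≠ i`, with indices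
ordered compatibly with the `i`-mode matricization. -/
noncomputable def kronFam {p q : Fin D → ℕ} (i : Fin D)
    (B : ∀ j, Matrix (Fin (p j)) (Fin (q j)) ℝ) : Matrix (CIdx p i) (CIdx q i) ℝ :=
  fun a b => ∏ j, B j.1 (a j) (b j)

/-- Frobenius norm of a tensor. -/
noncomputable def tfrob {n : Fin D → ℕ} (X : Tensor n) : ℝ := Real.sqrt (∑ idx, X idx ^ 2)

/-- Frobenius norm of a matrix. -/
noncomputable def mfrob {α β : Type*} [Fintype α] [Fintype β] (A : Matrix α β ℝ) : ℝ :=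
  Real.sqrt (∑ a, ∑ b, A a b ^ 2)

/-- Cast of the row index of a matrix along an equality of dimensions. -/
def rcast {a b : ℕ} (h : a = b) {c : Type*} (M : Matrix (Fin a) c ℝ) : Matrix (Fin b) c ℝ :=
  fun x y => M (Fin.cast h.symm x) y

/-- Cast of the column index of a matrix along an equality of dimensions. -/
def ccast {a b : ℕ} (h : a = b) {c : Type*} (M : Matrix c (Fin a) ℝ) : Matrix c (Fin b) ℝ :=
  fun x y => M x (Fin.cast h.symm y)

/-- Cast of a `CIdx` column index of a matrix along a family of equalities of dimensions. -/
def cidxcast {p q : Fin D → ℕ} (i : Fin D) (h : ∀ j : Fin D, j ≠ i → p j = q j) {c : Type*}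
    (M : Matrix c (CIdx p i) ℝ) : Matrix c (CIdx q i) ℝ :=
  fun x m => M x (fun j => Fin.cast (h j.1 j.2).symm (m j))

/-- `P` is the orthogonal projection onto the column space of `A`. -/
def IsOrthProjOnto {α β : Type*} [Fintype α] [Fintype β] (P : Matrix α α ℝ)
    (A : Matrix α β ℝ) : Prop :=
  Pᵀ = P ∧ P * P = P ∧ (∀ v, P.mulVec v ∈ LinearMap.range A.mulVecLin) ∧
    ∀ v ∈ LinearMap.range A.mulVecLin, P.mulVec v = v

/-- Mixed dimensions appearing in the mode-`i` subproblem of the nested Tucker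
integrator: `r j` for the already processed modes `j < i` and `n j` for the modes
`j ≥ i`. -/
def mdims (n r : Fin D → ℕ) (i : Fin D) : Fin D → ℕ := fun j => if j.1 < i.1 then r j else n j

lemma mdims_self (n r : Fin D → ℕ) (i : Fin D) : mdims n r i i = n i := if_neg (lt_irrefl _)

lemma mdims_lt (n r : Fin D → ℕ) {i j : Fin D} (h : j.1 < i.1) : mdims n r i j = r j := if_pos h

lemma mdims_not_lt (n r : Fin D → ℕ) {i j : Fin D} (h : ¬ j.1 < i.1) : mdims n r i j = n j :=
  if_neg h

lemma lt_last_of_ne {d : ℕ} {j : Fin (d + 1)} (hj : j ≠ Fin.last d) : j.1 < (Fin.last d).1 :=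
  Fin.val_lt_last hj

/-- Family of matrices realizing `X ↦ X ×_{k<i} (U k)ᵀ` as a multilinear product
`Tensor n → Tensor (mdims n r i)`. -/
noncomputable def projFam (n r : Fin D → ℕ) (i : Fin D)
    (U : ∀ j, Matrix (Fin (n j)) (Fin (r j)) ℝ) :
    ∀ j, Matrix (Fin (mdims n r i j)) (Fin (n j)) ℝ :=
  fun j => if h : j.1 < i.1 then rcast (mdims_lt n r h).symm (U j)ᵀ
    else rcast (mdims_not_lt n r h).symm 1

/-- Family of matrices realizing `X ↦ X ×_{k<i} U k` as a multilinear product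
`Tensor (mdims n r i) → Tensor n`. -/
noncomputable def liftFam (n r : Fin D → ℕ) (i : Fin D)
    (U : ∀ j, Matrix (Fin (n j)) (Fin (r j)) ℝ) :
    ∀ j, Matrix (Fin (n j)) (Fin (mdims n r i j)) ℝ :=
  fun j => if h : j.1 < i.1 then ccast (mdims_lt n r h).symm (U j)
    else ccast (mdims_not_lt n r h).symm 1

/-- Family of matrices realizing `X ↦ X ×_{k≥i, k≠i?} ...` namely identity for `k < i`
and `U k` for `k ≥ i`, as a multilinear product `Tensor r → Tensor (mdims n r i)`. -/
noncomputable def postFam (n r : Fin D → ℕ) (i : Fin D)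
    (U : ∀ j, Matrix (Fin (n j)) (Fin (r j)) ℝ) :
    ∀ j, Matrix (Fin (mdims n r i j)) (Fin (r j)) ℝ :=
  fun j => if h : j.1 < i.1 then rcast (mdims_lt n r h).symm 1
    else rcast (mdims_not_lt n r h).symm (U j)

/-- Kronecker factor family `I_{r_k}` for `k < i` and `(U k)ᵀ` for `k > i`, used to
build the corange matrix `V_i^{0,T}` of the nested Tucker integrator. -/
noncomputable def vFam (n r : Fin D → ℕ) (i : Fin D)
    (U : ∀ j, Matrix (Fin (n j)) (Fin (r j)) ℝ) :
    ∀ j, Matrix (Fin (r j)) (Fin (mdims n r i j)) ℝ :=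
  fun j => if h : j.1 < i.1 then ccast (mdims_lt n r h).symm 1
    else ccast (mdims_not_lt n r h).symm (U j)ᵀ

/-- The matrix `V_i^{0,T} = Q_i^{0,T} (⨂_{k<i} I_{r_k} ⊗ ⨂_{k>i} (U_k^0)ᵀ)` of the
nested Tucker integrator (Algorithm 1). -/
noncomputable def VT (n r : Fin D → ℕ) (i : Fin D)
    (U : ∀ j, Matrix (Fin (n j)) (Fin (r j)) ℝ) (Q : Matrix (CIdx r i) (Fin (r i)) ℝ) :
    Matrix (Fin (r i)) (CIdx (mdims n r i) i) ℝ :=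
  Qᵀ * kronFam i (vFam n r i U)

/-- The matrix `V̄_i^{0,T} = Q_i^{0,T} (⨂_{k<i} (U_k^1)ᵀ ⊗ ⨂_{k>i} (U_k^0)ᵀ)` of the
Tucker projector-splitting integrator of Lubich (Algorithm 2). -/
noncomputable def VTbar (n r : Fin D → ℕ) (i : Fin D)
    (U1 U0 : ∀ j, Matrix (Fin (n j)) (Fin (r j)) ℝ) (Q : Matrix (CIdx r i) (Fin (r i)) ℝ) :
    Matrix (Fin (r i)) (CIdx n i) ℝ :=
  Qᵀ * kronFam i (fun j => if j.1 < i.1 then (U1 j)ᵀ else (U0 j)ᵀ)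


/-- One step of the nested Tucker integrator (Algorithm 1) from `t0` to `t1`, from the
Tucker tensor `C⁰ ×_j U_j⁰` to the Tucker tensor `C¹ ×_j U_j¹`, with all substep
differential equations solved exactly.  The intermediate data are existentially
quantified: the updated cores `Ccur`, the QR factorizations `mat_i(C⁰)ᵀ = Q_i⁰ (S_i⁰)ᵀ`,
the K-step solutions `K_i` with QR factorizations `K_i(t1) = U_i¹ Ŝ_i¹`, the S-step
solutions `S_i`, the core updates, and the final L-step solution. -/
noncomputable def NestedStep {d : ℕ} (n r : Fin (d + 1) → ℕ)
    (F : ℝ → Tensor n → Tensor n) (t0 t1 : ℝ)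
    (C0 : Tensor r) (U0 : ∀ j, Matrix (Fin (n j)) (Fin (r j)) ℝ)
    (C1 : Tensor r) (U1 : ∀ j, Matrix (Fin (n j)) (Fin (r j)) ℝ) : Prop :=
  ∃ (Ccur : Fin (d + 2) → Tensor r)
    (Qm : ∀ i : Fin (d + 1), Matrix (CIdx r i) (Fin (r i)) ℝ)
    (S0m : ∀ i : Fin (d + 1), Matrix (Fin (r i)) (Fin (r i)) ℝ)
    (Km : ∀ i : Fin (d + 1), ℝ → Matrix (Fin (n i)) (Fin (r i)) ℝ)
    (Shat : ∀ i : Fin (d + 1), Matrix (Fin (r i)) (Fin (r i)) ℝ)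
    (Sm : ∀ i : Fin (d + 1), ℝ → Matrix (Fin (r i)) (Fin (r i)) ℝ)
    (Lt : ℝ → Matrix (Fin (r (Fin.last d))) (CIdx r (Fin.last d)) ℝ),
    Ccur 0 = C0 ∧
    -- QR factorization `mat_i(C⁰)ᵀ = Q_i⁰ (S_i⁰)ᵀ`
    (∀ i, (matr r i (Ccur i.castSucc))ᵀ = Qm i * (S0m i)ᵀ ∧ (Qm i)ᵀ * Qm i = 1) ∧
    -- K-step:  K̇_i(t) = mat_i(F(t, ten_i(K_i V_i^{0,T}) ×_{k<i} U_k¹) ×_{k<i} (U_k¹)ᵀ) V_i⁰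
    (∀ i, Km i t0 = U0 i * S0m i) ∧
    (∀ i, ∀ t ∈ Icc t0 t1, ∀ a b, HasDerivWithinAt (fun s => Km i s a b)
      ((rcast (mdims_self n r i) (matr (mdims n r i) i (mlprod (projFam n r i U1)
          (F t (mlprod (liftFam n r i U1) (tenr (mdims n r i) i
            (rcast (mdims_self n r i).symm (Km i t * VT n r i U0 (Qm i))))))))
        * (VT n r i U0 (Qm i))ᵀ) a b) (Icc t0 t1) t) ∧
    (∀ i, Km i t1 = U1 i * Shat i ∧ (U1 i)ᵀ * U1 i = 1) ∧
    -- S-step:  Ṡ_i(t) = -(U_i¹)ᵀ mat_i(F(t, ten_i(U_i¹ S_i V_i^{0,T}) ×_{k<i} U_k¹)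
    --                                   ×_{k<i} (U_k¹)ᵀ) V_i⁰
    (∀ i, Sm i t0 = Shat i) ∧
    (∀ i, ∀ t ∈ Icc t0 t1, ∀ a b, HasDerivWithinAt (fun s => Sm i s a b)
      ((-((U1 i)ᵀ * (rcast (mdims_self n r i) (matr (mdims n r i) i
          (mlprod (projFam n r i U1)
            (F t (mlprod (liftFam n r i U1) (tenr (mdims n r i) i
              (rcast (mdims_self n r i).symm (U1 i * Sm i t * VT n r i U0 (Qm i))))))))
        * (VT n r i U0 (Qm i))ᵀ))) a b) (Icc t0 t1) t) ∧
    -- core update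
    (∀ i : Fin (d + 1), Ccur i.succ = tenr r i (Sm i t1 * (Qm i)ᵀ)) ∧
    -- final L-step for the core
    Lt t0 = matr r (Fin.last d) (Ccur (Fin.last (d + 1))) ∧
    (∀ t ∈ Icc t0 t1, ∀ a b, HasDerivWithinAt (fun s => Lt s a b)
      ((cidxcast (Fin.last d) (fun j hj => mdims_lt n r (lt_last_of_ne hj))
        ((U1 (Fin.last d))ᵀ * rcast (mdims_self n r (Fin.last d))
          (matr (mdims n r (Fin.last d)) (Fin.last d)
            (mlprod (projFam n r (Fin.last d) U1)
              (F t (mlprod (liftFam n r (Fin.last d) U1)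
                (tenr (mdims n r (Fin.last d)) (Fin.last d)
                  (rcast (mdims_self n r (Fin.last d)).symm
                    (cidxcast (Fin.last d)
                      (fun j hj => (mdims_lt n r (lt_last_of_ne hj)).symm)
                      (U1 (Fin.last d) * Lt t)))))))))) a b) (Icc t0 t1) t) ∧
    C1 = tenr r (Fin.last d) (Lt t1)

set_option linter.unusedSectionVars false

/-! ### Matricization calculus -/

/-- Index gluing. -/
def glue (n : Fin D → ℕ) (i : Fin D) (k : Fin (n i)) (m : CIdx n i) : Idx n :=
  fun j => if h : j = i then Fin.cast (congrArg n h).symm k else m ⟨j, h⟩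

lemma glue_self (n : Fin D → ℕ) (i : Fin D) (k : Fin (n i)) (m : CIdx n i) :
    glue n i k m i = k := by simp [glue]

lemma glue_ne (n : Fin D → ℕ) (i : Fin D) (k : Fin (n i)) (m : CIdx n i)
    (j : {j : Fin D // j ≠ i}) : glue n i k m j.1 = m j := by
  simp [glue, j.2]

lemma glue_split (n : Fin D → ℕ) (i : Fin D) (x : Idx n) :
    glue n i (x i) (fun j => x j.1) = x := by
  funext j
  by_cases h : j = i
  · subst h; simp [glue]
  · simp [glue, h]

/-- Index splitting. -/
def splitEquiv (n : Fin D → ℕ) (i : Fin D) : Fin (n i) × CIdx n i ≃ Idx n where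
  toFun p := glue n i p.1 p.2
  invFun x := (x i, fun j => x j.1)
  left_inv p := by
    ext1
    · exact glue_self n i p.1 p.2
    · funext j; exact glue_ne n i p.1 p.2 j
  right_inv x := glue_split n i x

lemma matr_apply (n : Fin D → ℕ) (i : Fin D) (X : Tensor n) (k m) :
    matr n i X k m = X (glue n i k m) := rfl

lemma tenr_apply (n : Fin D → ℕ) (i : Fin D) (M) (x : Idx n) :
    tenr n i M x = M (x i) (fun j => x j.1) := rfl

lemma matr_tenr (n : Fin D → ℕ) (i : Fin D) (M) : matr n i (tenr n i M) = M := by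
  ext k m
  rw [matr_apply, tenr_apply, glue_self]
  congr 1
  funext j
  exact glue_ne n i k m j

lemma tenr_matr (n : Fin D → ℕ) (i : Fin D) (X : Tensor n) : tenr n i (matr n i X) = X := by
  funext x
  rw [tenr_apply, matr_apply, glue_split]

lemma tfrob_tenr (n : Fin D → ℕ) (i : Fin D) (M) : tfrob (tenr n i M) = mfrob M := by
  unfold tfrob mfrob
  congr 1
  rw [← (splitEquiv n i).sum_comp, Fintype.sum_prod_type]
  refine Finset.sum_congr rfl fun k _ => Finset.sum_congr rfl fun m _ => ?_
  change (matr n i (tenr n i M) k m) ^ 2 = _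
  rw [matr_tenr]

lemma tfrob_eq_mfrob (n : Fin D → ℕ) (i : Fin D) (X : Tensor n) :
    tfrob X = mfrob (matr n i X) := by
  rw [← tfrob_tenr, tenr_matr]

lemma matr_mlprod {n m : Fin D → ℕ} (i : Fin D) (B : ∀ j, Matrix (Fin (m j)) (Fin (n j)) ℝ)
    (X : Tensor n) :
    matr m i (mlprod B X) = B i * matr n i X * (kronFam i B)ᵀ := by
  ext k c
  rw [matr_apply]
  simp only [mlprod, Matrix.mul_apply, Matrix.transpose_apply, kronFam]
  rw [← (splitEquiv n i).sum_comp, Fintype.sum_prod_type, Finset.sum_comm]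
  refine Finset.sum_congr rfl fun b _ => ?_
  rw [Finset.sum_mul]
  refine Finset.sum_congr rfl fun a _ => ?_
  change (∏ j, B j (glue m i k c j) (glue n i a b j)) * X (glue n i a b) = _
  rw [matr_apply, Fintype.prod_eq_mul_prod_subtype_ne _ i, glue_self, glue_self]
  have : ∀ j : {j : Fin D // j ≠ i}, B j.1 (glue m i k c j.1) (glue n i a b j.1)
      = B j.1 (c j) (b j) := fun j => by rw [glue_ne, glue_ne]
  simp only [this]
  ring

lemma kronFam_mul {p q s : Fin D → ℕ} (i : Fin D) (B : ∀ j, Matrix (Fin (p j)) (Fin (q j)) ℝ)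
    (C : ∀ j, Matrix (Fin (q j)) (Fin (s j)) ℝ) :
    kronFam i B * kronFam i C = kronFam i (fun j => B j * C j) := by
  ext a b
  simp only [kronFam, Matrix.mul_apply, ← Finset.prod_mul_distrib]
  rw [Finset.prod_univ_sum]
  simp

lemma kronFam_transpose {p q : Fin D → ℕ} (i : Fin D)
    (B : ∀ j, Matrix (Fin (p j)) (Fin (q j)) ℝ) :
    (kronFam i B)ᵀ = kronFam i (fun j => (B j)ᵀ) := rfl

lemma kronFam_congr {p q : Fin D → ℕ} (i : Fin D)
    {B C : ∀ j, Matrix (Fin (p j)) (Fin (q j)) ℝ} (h : ∀ j, j ≠ i → B j = C j) :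
    kronFam i B = kronFam i C := by
  ext a b
  simp only [kronFam]
  exact Finset.prod_congr rfl fun j _ => by rw [h j.1 j.2]

lemma kronFam_one {p : Fin D → ℕ} (i : Fin D) :
    kronFam i (fun j => (1 : Matrix (Fin (p j)) (Fin (p j)) ℝ)) = 1 := by
  ext a b
  simp only [kronFam, Matrix.one_apply]
  by_cases h : a = b
  · subst h; simp
  · rw [if_neg h]
    obtain ⟨j, hj⟩ := Function.ne_iff.mp h
    exact Finset.prod_eq_zero (Finset.mem_univ j) (if_neg hj)

/-! ### Frobenius norm -/

lemma tfrob_eq_norm {n : Fin D → ℕ} (X : Tensor n) :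
    tfrob X = ‖(WithLp.toLp 2 X : EuclideanSpace ℝ (Idx n))‖ := by
  rw [EuclideanSpace.norm_eq]
  simp [tfrob]

lemma tfrob_nonneg {n : Fin D → ℕ} (X : Tensor n) : 0 ≤ tfrob X := Real.sqrt_nonneg _

lemma tfrob_add_le {n : Fin D → ℕ} (X Y : Tensor n) : tfrob (X + Y) ≤ tfrob X + tfrob Y := by
  simp only [tfrob_eq_norm, WithLp.toLp_add]
  exact norm_add_le _ _

lemma tfrob_sub_le {n : Fin D → ℕ} (X Y : Tensor n) : tfrob (X - Y) ≤ tfrob X + tfrob Y := by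
  simp only [tfrob_eq_norm, WithLp.toLp_sub]
  exact norm_sub_le _ _

lemma tfrob_neg {n : Fin D → ℕ} (X : Tensor n) : tfrob (-X) = tfrob X := by
  simp only [tfrob_eq_norm, WithLp.toLp_neg]
  exact norm_neg _

lemma tfrob_zero {n : Fin D → ℕ} : tfrob (0 : Tensor n) = 0 := by
  simp [tfrob]

lemma tfrob_smul {n : Fin D → ℕ} (c : ℝ) (X : Tensor n) : tfrob (c • X) = |c| * tfrob X := by
  simp only [tfrob_eq_norm, WithLp.toLp_smul]
  exact norm_smul _ _

lemma tfrob_sum_le {n : Fin D → ℕ} {κ : Type*} (s : Finset κ) (X : κ → Tensor n) :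
    tfrob (∑ k ∈ s, X k) ≤ ∑ k ∈ s, tfrob (X k) := by
  classical
  induction s using Finset.induction_on with
  | empty => simp [tfrob_zero]
  | insert a s ha ih =>
    rw [Finset.sum_insert ha, Finset.sum_insert ha]
    exact (tfrob_add_le _ _).trans (by linarith)

lemma tfrob_mvt {n : Fin D → ℕ} {a b C : ℝ} {f f' : ℝ → Tensor n}
    (hd : ∀ t ∈ Icc a b, ∀ x, HasDerivWithinAt (fun s => f s x) (f' t x) (Icc a b) t)
    (hC : ∀ t ∈ Icc a b, tfrob (f' t) ≤ C) {t : ℝ} (ht : t ∈ Icc a b) :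
    tfrob (f t - f a) ≤ C * (t - a) := by
  have h1 : ∀ t ∈ Icc a b, HasDerivWithinAt
      (fun s => (WithLp.toLp 2 (f s) : EuclideanSpace ℝ (Idx n))) (WithLp.toLp 2 (f' t))
      (Icc a b) t := by
    intro t ht
    have h0 : HasDerivWithinAt f (f' t) (Icc a b) t := hasDerivWithinAt_pi.2 (hd t ht)
    exact (PiLp.hasFDerivAt_toLp 2 (f t)).comp_hasDerivWithinAt t h0
  have h2 := (convex_Icc a b).norm_image_sub_le_of_norm_hasDerivWithin_le (x := a) (y := t)
    h1 (fun t ht => by rw [← tfrob_eq_norm]; exact hC t ht) ⟨le_rfl, ht.1.trans ht.2⟩ ht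
  rw [← WithLp.toLp_sub, ← tfrob_eq_norm, Real.norm_eq_abs, abs_of_nonneg (by linarith [ht.1])] at h2
  exact h2

section mf
variable {α β : Type*} [Fintype α] [Fintype β] [DecidableEq α] [DecidableEq β]

lemma mfrob_sq (A : Matrix α β ℝ) : mfrob A ^ 2 = (Aᵀ * A).trace := by
  have hn : 0 ≤ ∑ a, ∑ b, A a b ^ 2 :=
    Finset.sum_nonneg fun _ _ => Finset.sum_nonneg fun _ _ => sq_nonneg _
  refine (Real.sq_sqrt hn).trans ?_
  rw [Finset.sum_comm]
  simp [Matrix.trace, Matrix.mul_apply, sq]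

lemma mfrob_nonneg (A : Matrix α β ℝ) : 0 ≤ mfrob A := Real.sqrt_nonneg _

lemma mfrob_transpose (A : Matrix α β ℝ) : mfrob Aᵀ = mfrob A := by
  unfold mfrob
  rw [Finset.sum_comm]
  rfl

lemma mfrob_proj_mul (P : Matrix α α ℝ) (h1 : Pᵀ = P) (h2 : P * P = P) (A : Matrix α β ℝ) :
    mfrob (P * A) ≤ mfrob A := by
  have e : mfrob A ^ 2 = mfrob (P * A) ^ 2 + mfrob ((1 - P) * A) ^ 2 := by
    rw [mfrob_sq, mfrob_sq, mfrob_sq, ← Matrix.trace_add]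
    congr 1
    have h3 : (1 - P)ᵀ * (1 - P) = 1 - P := by
      rw [Matrix.transpose_sub, h1, Matrix.transpose_one, Matrix.sub_mul, Matrix.mul_sub,
        Matrix.mul_sub, h2]
      simp
    rw [Matrix.transpose_mul, Matrix.transpose_mul, Matrix.mul_assoc, ← Matrix.mul_assoc Pᵀ,
      Matrix.mul_assoc _ _ ((1 - P) * A), ← Matrix.mul_assoc (1 - P)ᵀ, h3, h1, h2,
      ← Matrix.mul_add, ← Matrix.add_mul]
    simp
  exact abs_le_of_sq_le_sq' (by nlinarith [sq_nonneg (mfrob ((1 - P) * A))]) (mfrob_nonneg _) |>.2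

lemma mfrob_mul_proj (P : Matrix β β ℝ) (h1 : Pᵀ = P) (h2 : P * P = P) (A : Matrix α β ℝ) :
    mfrob (A * P) ≤ mfrob A := by
  rw [← mfrob_transpose, ← mfrob_transpose A, Matrix.transpose_mul, h1]
  exact mfrob_proj_mul P h1 h2 _

lemma orth_symm (U : Matrix α β ℝ) : (U * Uᵀ)ᵀ = U * Uᵀ := by
  rw [Matrix.transpose_mul, Matrix.transpose_transpose]

lemma orth_idem (U : Matrix α β ℝ) (h : Uᵀ * U = 1) : (U * Uᵀ) * (U * Uᵀ) = U * Uᵀ := by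
  rw [Matrix.mul_assoc, ← Matrix.mul_assoc Uᵀ, h, Matrix.one_mul]

lemma compl_symm (P : Matrix α α ℝ) (h : Pᵀ = P) : (1 - P)ᵀ = 1 - P := by
  rw [Matrix.transpose_sub, h, Matrix.transpose_one]

lemma compl_idem (P : Matrix α α ℝ) (h : P * P = P) : (1 - P) * (1 - P) = 1 - P := by
  rw [Matrix.sub_mul, Matrix.mul_sub, Matrix.mul_sub, h]
  simp

end mf

lemma hasDeriv_mul {α β γ δ : Type*} [Fintype α] [Fintype β] [Fintype γ] [Fintype δ]
    (M : Matrix α β ℝ) (N : Matrix γ δ ℝ) {K : ℝ → Matrix β γ ℝ} {K' : Matrix β γ ℝ}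
    {s : Set ℝ} {t : ℝ}
    (h : ∀ a b, HasDerivWithinAt (fun x => K x a b) (K' a b) s t) (a b) :
    HasDerivWithinAt (fun x => (M * K x * N) a b) ((M * K' * N) a b) s t := by
  simp only [Matrix.mul_apply]
  refine HasDerivWithinAt.fun_sum fun j _ => HasDerivWithinAt.mul_const ?_ _
  exact HasDerivWithinAt.fun_sum fun k _ => (h k j).const_mul _

lemma hasDeriv_mlprod {n m : Fin D → ℕ} (B : ∀ j, Matrix (Fin (m j)) (Fin (n j)) ℝ)
    {X : ℝ → Tensor n} {X' : Tensor n} {s : Set ℝ} {t : ℝ}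
    (h : ∀ a, HasDerivWithinAt (fun x => X x a) (X' a) s t) (a) :
    HasDerivWithinAt (fun x => mlprod B (X x) a) (mlprod B X' a) s t := by
  simp only [mlprod]
  exact HasDerivWithinAt.fun_sum fun k _ => (h k).const_mul _

/-! ### Eliminating the casts -/

lemma ccast_mul_rcast {a b : ℕ} (h : a = b) {c e : Type*} (M : Matrix c (Fin a) ℝ)
    (N : Matrix (Fin a) e ℝ) : ccast h M * rcast h N = M * N := by
  subst h; rfl

lemma rcast_mul {a b : ℕ} (h : a = b) {c e : Type*} [Fintype c] (M : Matrix (Fin a) c ℝ)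
    (N : Matrix c e ℝ) : rcast h (M * N) = rcast h M * N := by
  subst h; rfl

lemma rcast_rcast {a b : ℕ} (h : a = b) (h' : b = a) {c : Type*} (M : Matrix (Fin a) c ℝ) :
    rcast h' (rcast h M) = M := by
  subst h; rfl

lemma ccast_transpose {a b : ℕ} (h : a = b) {c : Type*} (M : Matrix c (Fin a) ℝ) :
    (ccast h M)ᵀ = rcast h Mᵀ := rfl

/-- Mixed basis: `U1` for modes `< k`, `U0` for the others. -/
def mix {n r : Fin D → ℕ} (U1 U0 : ∀ j, Matrix (Fin (n j)) (Fin (r j)) ℝ) (k : ℕ) :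
    ∀ j, Matrix (Fin (n j)) (Fin (r j)) ℝ := fun j => if j.1 < k then U1 j else U0 j

/-- The corange basis in the full space. -/
noncomputable def Wm {n r : Fin D → ℕ} (U1 U0 : ∀ j, Matrix (Fin (n j)) (Fin (r j)) ℝ)
    (i : Fin D) (Q : Matrix (CIdx r i) (Fin (r i)) ℝ) : Matrix (CIdx n i) (Fin (r i)) ℝ :=
  kronFam i (mix U1 U0 i.1) * Q

lemma projFam_eq (n r : Fin D → ℕ) (i : Fin D) (U : ∀ j, Matrix (Fin (n j)) (Fin (r j)) ℝ) (j) :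
    projFam n r i U j = (liftFam n r i U j)ᵀ := by
  unfold projFam liftFam
  split_ifs with h
  · rfl
  · rw [ccast_transpose, Matrix.transpose_one]

lemma vFam_mul_lift (n r : Fin D → ℕ) (i : Fin D)
    (U1 U0 : ∀ j, Matrix (Fin (n j)) (Fin (r j)) ℝ) (j) :
    vFam n r i U0 j * (liftFam n r i U1 j)ᵀ = (mix U1 U0 i.1 j)ᵀ := by
  unfold vFam liftFam mix
  split_ifs with h
  · rw [ccast_transpose, ccast_mul_rcast, Matrix.one_mul]
  · rw [ccast_transpose, ccast_mul_rcast, Matrix.transpose_one, Matrix.mul_one]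

lemma VT_mul_lift (n r : Fin D → ℕ) (i : Fin D)
    (U1 U0 : ∀ j, Matrix (Fin (n j)) (Fin (r j)) ℝ) (Q) :
    VT n r i U0 Q * (kronFam i (liftFam n r i U1))ᵀ = (Wm U1 U0 i Q)ᵀ := by
  unfold VT Wm
  rw [kronFam_transpose, Matrix.mul_assoc, kronFam_mul, Matrix.transpose_mul, kronFam_transpose]
  simp only [vFam_mul_lift]

lemma matr_injective {n : Fin D → ℕ} (i : Fin D) {X Y : Tensor n}
    (h : matr n i X = matr n i Y) : X = Y := by
  rw [← tenr_matr n i X, h, tenr_matr]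

lemma liftFam_self (n r : Fin D → ℕ) (i : Fin D) (U : ∀ j, Matrix (Fin (n j)) (Fin (r j)) ℝ) :
    liftFam n r i U i = ccast (mdims_self n r i).symm 1 := by
  unfold liftFam
  rw [dif_neg (lt_irrefl _)]

lemma lift_K (n r : Fin D → ℕ) (i : Fin D)
    (U1 U0 : ∀ j, Matrix (Fin (n j)) (Fin (r j)) ℝ) (Q) (N : Matrix (Fin (n i)) (Fin (r i)) ℝ) :
    mlprod (liftFam n r i U1) (tenr (mdims n r i) i
      (rcast (mdims_self n r i).symm (N * VT n r i U0 Q))) = tenr n i (N * (Wm U1 U0 i Q)ᵀ) := by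
  apply matr_injective i
  rw [matr_mlprod, matr_tenr, matr_tenr, liftFam_self, ccast_mul_rcast, Matrix.one_mul,
    Matrix.mul_assoc, VT_mul_lift]

lemma rcast_matr_proj (n r : Fin D → ℕ) (i : Fin D)
    (U1 : ∀ j, Matrix (Fin (n j)) (Fin (r j)) ℝ) (X : Tensor n) :
    rcast (mdims_self n r i) (matr (mdims n r i) i (mlprod (projFam n r i U1) X))
      = matr n i X * kronFam i (liftFam n r i U1) := by
  have h1 : projFam n r i U1 i = rcast (mdims_self n r i).symm 1 := by
    rw [projFam_eq, liftFam_self, ccast_transpose, Matrix.transpose_one]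
  rw [matr_mlprod, h1, rcast_mul, rcast_mul, rcast_rcast, Matrix.one_mul, kronFam_transpose]
  simp only [projFam_eq, Matrix.transpose_transpose]

lemma proj_K (n r : Fin D → ℕ) (i : Fin D)
    (U1 U0 : ∀ j, Matrix (Fin (n j)) (Fin (r j)) ℝ) (Q) (X : Tensor n) :
    rcast (mdims_self n r i) (matr (mdims n r i) i (mlprod (projFam n r i U1) X))
      * (VT n r i U0 Q)ᵀ = matr n i X * Wm U1 U0 i Q := by
  rw [rcast_matr_proj, Matrix.mul_assoc]
  congr 1
  have := congrArg Matrix.transpose (VT_mul_lift n r i U1 U0 Q)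
  rwa [Matrix.transpose_mul, Matrix.transpose_transpose, Matrix.transpose_transpose] at this

lemma cidxcast_mul {p q m : Fin D → ℕ} (i : Fin D) (h : ∀ j : Fin D, j ≠ i → p j = q j)
    {c : Type*} (M : Matrix c (CIdx p i) ℝ) (B : ∀ j, Matrix (Fin (m j)) (Fin (q j)) ℝ)
    (C : ∀ j, Matrix (Fin (m j)) (Fin (p j)) ℝ)
    (hB : ∀ j (hj : j ≠ i), B j = ccast (h j hj) (C j)) :
    cidxcast i h M * (kronFam i B)ᵀ = M * (kronFam i C)ᵀ := by
  ext x y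
  simp only [Matrix.mul_apply, Matrix.transpose_apply, kronFam]
  let e : CIdx q i ≃ CIdx p i :=
    Equiv.piCongrRight fun j : {j : Fin D // j ≠ i} => finCongr (h j.1 j.2).symm
  rw [← e.sum_comp]
  refine Finset.sum_congr rfl fun z _ => ?_
  congr 1
  refine Finset.prod_congr rfl fun j _ => ?_
  rw [hB j.1 j.2]
  rfl

lemma lift_L {d : ℕ} (n r : Fin (d + 1) → ℕ)
    (U1 : ∀ j, Matrix (Fin (n j)) (Fin (r j)) ℝ)
    (N : Matrix (Fin (r (Fin.last d))) (CIdx r (Fin.last d)) ℝ) :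
    mlprod (liftFam n r (Fin.last d) U1) (tenr (mdims n r (Fin.last d)) (Fin.last d)
      (rcast (mdims_self n r (Fin.last d)).symm
        (cidxcast (Fin.last d) (fun j hj => (mdims_lt n r (lt_last_of_ne hj)).symm)
          (U1 (Fin.last d) * N)))) = mlprod U1 (tenr r (Fin.last d) N) := by
  apply matr_injective (Fin.last d)
  rw [matr_mlprod, matr_tenr, liftFam_self, ccast_mul_rcast, Matrix.one_mul, matr_mlprod,
    matr_tenr]
  refine cidxcast_mul _ _ _ _ _ fun j hj => ?_
  unfold liftFam
  rw [dif_pos (lt_last_of_ne hj)]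

lemma proj_L {d : ℕ} (n r : Fin (d + 1) → ℕ)
    (U1 : ∀ j, Matrix (Fin (n j)) (Fin (r j)) ℝ) (X : Tensor n) :
    cidxcast (Fin.last d) (fun j hj => mdims_lt n r (lt_last_of_ne hj))
        ((U1 (Fin.last d))ᵀ * rcast (mdims_self n r (Fin.last d))
          (matr (mdims n r (Fin.last d)) (Fin.last d)
            (mlprod (projFam n r (Fin.last d) U1) X)))
      = matr r (Fin.last d) (mlprod (fun j => (U1 j)ᵀ) X) := by
  rw [rcast_matr_proj, matr_mlprod, ← Matrix.mul_assoc]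
  generalize (U1 (Fin.last d))ᵀ * matr n (Fin.last d) X = G
  ext x y
  simp only [cidxcast, Matrix.mul_apply, Matrix.transpose_apply, kronFam]
  refine Finset.sum_congr rfl fun z _ => ?_
  congr 1
  refine Finset.prod_congr rfl fun j _ => ?_
  unfold liftFam
  rw [dif_pos (lt_last_of_ne j.2)]
  rfl

/-! ### Orthonormality -/

lemma mix_orth {n r : Fin D → ℕ} {U1 U0 : ∀ j, Matrix (Fin (n j)) (Fin (r j)) ℝ}
    (h1 : ∀ j, (U1 j)ᵀ * U1 j = 1) (h0 : ∀ j, (U0 j)ᵀ * U0 j = 1) (k : ℕ) (j) :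
    (mix U1 U0 k j)ᵀ * mix U1 U0 k j = 1 := by
  unfold mix
  split_ifs
  · exact h1 j
  · exact h0 j

lemma Wm_orth {n r : Fin D → ℕ} {U1 U0 : ∀ j, Matrix (Fin (n j)) (Fin (r j)) ℝ}
    (h1 : ∀ j, (U1 j)ᵀ * U1 j = 1) (h0 : ∀ j, (U0 j)ᵀ * U0 j = 1) (i : Fin D)
    {Q : Matrix (CIdx r i) (Fin (r i)) ℝ} (hQ : Qᵀ * Q = 1) :
    (Wm U1 U0 i Q)ᵀ * Wm U1 U0 i Q = 1 := by
  unfold Wm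
  rw [Matrix.transpose_mul, Matrix.mul_assoc, ← Matrix.mul_assoc _ _ Q, kronFam_transpose,
    kronFam_mul]
  simp only [mix_orth h1 h0]
  rw [kronFam_one, Matrix.one_mul, hQ]

/-- Partial projection family. -/
noncomputable def pfam {n r : Fin D → ℕ} (U1 : ∀ j, Matrix (Fin (n j)) (Fin (r j)) ℝ) (k : ℕ) :
    ∀ j, Matrix (Fin (n j)) (Fin (n j)) ℝ := fun j => if j.1 < k then U1 j * (U1 j)ᵀ else 1

lemma pfam_symm {n r : Fin D → ℕ} (U1 : ∀ j, Matrix (Fin (n j)) (Fin (r j)) ℝ) (k : ℕ) (j) :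
    (pfam U1 k j)ᵀ = pfam U1 k j := by
  unfold pfam
  split_ifs
  · exact orth_symm _
  · exact Matrix.transpose_one

lemma pfam_idem {n r : Fin D → ℕ} {U1 : ∀ j, Matrix (Fin (n j)) (Fin (r j)) ℝ}
    (h1 : ∀ j, (U1 j)ᵀ * U1 j = 1) (k : ℕ) (j) :
    pfam U1 k j * pfam U1 k j = pfam U1 k j := by
  unfold pfam
  split_ifs
  · exact orth_idem _ (h1 j)
  · exact Matrix.mul_one _

lemma kron_pfam_symm {n r : Fin D → ℕ} (U1 : ∀ j, Matrix (Fin (n j)) (Fin (r j)) ℝ) (k : ℕ) (i) :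
    (kronFam i (pfam U1 k))ᵀ = kronFam i (pfam U1 k) := by
  rw [kronFam_transpose]; simp only [pfam_symm]

lemma kron_pfam_idem {n r : Fin D → ℕ} {U1 : ∀ j, Matrix (Fin (n j)) (Fin (r j)) ℝ}
    (h1 : ∀ j, (U1 j)ᵀ * U1 j = 1) (k : ℕ) (i) :
    kronFam i (pfam U1 k) * kronFam i (pfam U1 k) = kronFam i (pfam U1 k) := by
  rw [kronFam_mul]; simp only [pfam_idem h1]

lemma Wm_pfam {n r : Fin D → ℕ} {U1 : ∀ j, Matrix (Fin (n j)) (Fin (r j)) ℝ}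
    (U0 : ∀ j, Matrix (Fin (n j)) (Fin (r j)) ℝ)
    (h1 : ∀ j, (U1 j)ᵀ * U1 j = 1) (i : Fin D) (Q : Matrix (CIdx r i) (Fin (r i)) ℝ) :
    (Wm U1 U0 i Q)ᵀ * kronFam i (pfam U1 i.1) = (Wm U1 U0 i Q)ᵀ := by
  unfold Wm
  rw [Matrix.transpose_mul, Matrix.mul_assoc, kronFam_transpose, kronFam_mul]
  congr 2
  funext j
  unfold mix pfam
  split_ifs
  · rw [← Matrix.mul_assoc, h1, Matrix.one_mul]
  · rw [Matrix.mul_one]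

lemma mlprod_pfam_le {n r : Fin D → ℕ} {U1 : ∀ j, Matrix (Fin (n j)) (Fin (r j)) ℝ}
    (h1 : ∀ j, (U1 j)ᵀ * U1 j = 1) (k : ℕ) (i : Fin D) (X : Tensor n) :
    tfrob (mlprod (pfam U1 k) X) ≤ tfrob X := by
  rw [tfrob_eq_mfrob n i, tfrob_eq_mfrob n i, matr_mlprod, kron_pfam_symm]
  exact (mfrob_mul_proj _ (kron_pfam_symm _ _ _) (kron_pfam_idem h1 _ _) _).trans
    (mfrob_proj_mul _ (pfam_symm _ _ _) (pfam_idem h1 _ _) _)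

lemma mlprod_mlprod {p q s : Fin D → ℕ} (B : ∀ j, Matrix (Fin (p j)) (Fin (q j)) ℝ)
    (C : ∀ j, Matrix (Fin (q j)) (Fin (s j)) ℝ) (i : Fin D) (X : Tensor s) :
    mlprod B (mlprod C X) = mlprod (fun j => B j * C j) X := by
  apply matr_injective i
  rw [matr_mlprod, matr_mlprod, matr_mlprod, ← kronFam_mul, Matrix.transpose_mul]
  simp only [Matrix.mul_assoc]

/-- The key remainder identity. -/
lemma remainder_matr {n r : Fin D → ℕ} {U1 : ∀ j, Matrix (Fin (n j)) (Fin (r j)) ℝ}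
    (U0 : ∀ j, Matrix (Fin (n j)) (Fin (r j)) ℝ)
    (h1 : ∀ j, (U1 j)ᵀ * U1 j = 1) (i : Fin D) (Q : Matrix (CIdx r i) (Fin (r i)) ℝ)
    (X : Tensor n) :
    matr n i (mlprod (pfam U1 i.1) X) - matr n i (mlprod (pfam U1 (i.1 + 1)) X)
      - (1 - U1 i * (U1 i)ᵀ) * matr n i X * (Wm U1 U0 i Q * (Wm U1 U0 i Q)ᵀ)
    = (1 - U1 i * (U1 i)ᵀ) * matr n i X * (1 - Wm U1 U0 i Q * (Wm U1 U0 i Q)ᵀ)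
      * kronFam i (pfam U1 i.1) := by
  have e1 : pfam U1 i.1 i = 1 := if_neg (lt_irrefl _)
  have e2 : pfam U1 (i.1 + 1) i = U1 i * (U1 i)ᵀ := if_pos (Nat.lt_succ_self _)
  have e3 : kronFam i (pfam U1 (i.1 + 1)) = kronFam i (pfam U1 i.1) := by
    apply kronFam_congr
    intro j hj
    have : j.1 ≠ i.1 := fun h => hj (Fin.ext h)
    unfold pfam
    congr 1
    simp only [eq_iff_iff]
    omega
  have e4 := Wm_pfam U0 h1 i Q
  rw [matr_mlprod, matr_mlprod, e1, e2, e3, kron_pfam_symm]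
  rw [Matrix.mul_assoc _ (1 - Wm U1 U0 i Q * (Wm U1 U0 i Q)ᵀ), Matrix.sub_mul 1 (Wm U1 U0 i Q * _),
    Matrix.mul_assoc (Wm U1 U0 i Q), e4, Matrix.mul_sub]
  simp only [Matrix.sub_mul, Matrix.one_mul]

/-! ### The non-tangential bound on the closure of the rank-`r` manifold -/

lemma isOrthProj {α β : Type*} [Fintype α] [Fintype β] [DecidableEq α] [DecidableEq β] {k : ℕ}
    (U : Matrix α (Fin k) ℝ) (W : Matrix β (Fin k) ℝ) (S : Matrix (Fin k) (Fin k) ℝ)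
    (hU : Uᵀ * U = 1) (hW : Wᵀ * W = 1) (hS : IsUnit S.det) :
    IsOrthProjOnto (U * Uᵀ) (U * S * Wᵀ) := by
  refine ⟨orth_symm U, orth_idem U hU, ?_, ?_⟩
  · intro v
    refine ⟨(W * S⁻¹ * Uᵀ).mulVec v, ?_⟩
    rw [Matrix.mulVecLin_apply, Matrix.mulVec_mulVec]
    congr 1
    calc U * S * Wᵀ * (W * S⁻¹ * Uᵀ) = U * (S * (Wᵀ * W) * S⁻¹) * Uᵀ := by
          simp only [Matrix.mul_assoc]
      _ = U * Uᵀ := by rw [hW, Matrix.mul_one, Matrix.mul_nonsing_inv _ hS, Matrix.mul_one]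
  · rintro v ⟨x, rfl⟩
    rw [Matrix.mulVecLin_apply, Matrix.mulVec_mulVec]
    congr 1
    calc U * Uᵀ * (U * S * Wᵀ) = U * (Uᵀ * U) * S * Wᵀ := by simp only [Matrix.mul_assoc]
      _ = U * S * Wᵀ := by rw [hU, Matrix.mul_one]

lemma rank_usw {α β : Type*} [Fintype α] [Fintype β] [DecidableEq α] [DecidableEq β] {k : ℕ}
    (U : Matrix α (Fin k) ℝ) (W : Matrix β (Fin k) ℝ) (S : Matrix (Fin k) (Fin k) ℝ)
    (hU : Uᵀ * U = 1) (hW : Wᵀ * W = 1) (hS : IsUnit S.det) :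
    (U * S * Wᵀ).rank = k := by
  apply le_antisymm
  · rw [Matrix.mul_assoc]
    refine (Matrix.rank_mul_le_left _ _).trans ?_
    simpa using Matrix.rank_le_card_width U
  · have h1 : S = Uᵀ * (U * S * Wᵀ) * W := by
      calc S = (Uᵀ * U) * S * (Wᵀ * W) := by rw [hU, hW, Matrix.one_mul, Matrix.mul_one]
        _ = _ := by simp only [Matrix.mul_assoc]
    have h2 : S.rank = k := by
      rw [Matrix.rank_of_isUnit S ((Matrix.isUnit_iff_isUnit_det S).2 hS)]
      simp
    calc k = S.rank := h2.symm
      _ = (Uᵀ * (U * S * Wᵀ) * W).rank := by rw [← h1]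
      _ ≤ (Uᵀ * (U * S * Wᵀ)).rank := Matrix.rank_mul_le_left _ _
      _ ≤ _ := Matrix.rank_mul_le_right _ _

lemma exists_invertible_near {k : ℕ} (S : Matrix (Fin k) (Fin k) ℝ) {η : ℝ} (hη : 0 < η) :
    ∃ δ : ℝ, |δ| < η ∧ IsUnit (S + δ • (1 : Matrix (Fin k) (Fin k) ℝ)).det := by
  have hfin : {x : ℝ | (-S).charpoly.IsRoot x}.Finite :=
    Polynomial.finite_setOf_isRoot (Matrix.charpoly_monic _).ne_zero
  obtain ⟨δ, hδ, hn⟩ := (Set.Ioo_infinite hη).exists_notMem_finite hfin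
  refine ⟨δ, by rw [abs_of_pos hδ.1]; exact hδ.2, ?_⟩
  rw [isUnit_iff_ne_zero]
  intro h
  apply hn
  change (-S).charpoly.eval δ = 0
  rw [Matrix.eval_charpoly, ← h]
  congr 1
  rw [sub_neg_eq_add, add_comm, Matrix.smul_one_eq_diagonal]
  rfl

lemma mfrob_add_smul_bound {n : Fin D → ℕ} (i : Fin D) {P : Matrix (Fin (n i)) (Fin (n i)) ℝ}
    {Q : Matrix (CIdx n i) (CIdx n i) ℝ} (hP : Pᵀ = P) (hP2 : P * P = P) (hQ : Qᵀ = Q)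
    (hQ2 : Q * Q = Q) (X Y : Tensor n) :
    mfrob (P * matr n i X * Q) ≤ mfrob (P * matr n i Y * Q) + tfrob (X - Y) := by
  have h : tenr n i (P * matr n i X * Q) = tenr n i (P * matr n i Y * Q)
      + tenr n i (P * matr n i (X - Y) * Q) := by
    have : matr n i (X - Y) = matr n i X - matr n i Y := rfl
    rw [this, Matrix.mul_sub, Matrix.sub_mul]
    funext x
    simp [tenr]
  rw [← tfrob_tenr, h]
  refine (tfrob_add_le _ _).trans ?_
  rw [tfrob_tenr, tfrob_tenr, tfrob_eq_mfrob n i]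
  gcongr
  exact (mfrob_mul_proj _ hQ hQ2 _).trans (mfrob_proj_mul _ hP hP2 _)

lemma eps_bound {n r : Fin D → ℕ} (i : Fin D) (G : Tensor n → Tensor n) {L ε : ℝ}
    (hL : ∀ Y Y' : Tensor n, tfrob (G Y - G Y') ≤ L * tfrob (Y - Y'))
    (hε : ∀ Y : Tensor n, (matr n i Y).rank = r i →
      ∀ (P : Matrix (Fin (n i)) (Fin (n i)) ℝ) (Q : Matrix (CIdx n i) (CIdx n i) ℝ),
        IsOrthProjOnto P (matr n i Y) → IsOrthProjOnto Q (matr n i Y)ᵀ →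
        mfrob ((1 - P) * matr n i (G Y) * (1 - Q)) ≤ ε)
    (U : Matrix (Fin (n i)) (Fin (r i)) ℝ) (W : Matrix (CIdx n i) (Fin (r i)) ℝ)
    (S : Matrix (Fin (r i)) (Fin (r i)) ℝ) (hU : Uᵀ * U = 1) (hW : Wᵀ * W = 1) :
    mfrob ((1 - U * Uᵀ) * matr n i (G (tenr n i (U * S * Wᵀ))) * (1 - W * Wᵀ)) ≤ ε := by
  apply le_of_forall_pos_le_add
  intro η hη
  set c : ℝ := |L| * tfrob (tenr n i (U * Wᵀ)) with hc
  have hc0 : 0 ≤ c := mul_nonneg (abs_nonneg _) (tfrob_nonneg _)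
  obtain ⟨δ, hδ, hdet⟩ := exists_invertible_near S (η := η / (c + 1)) (by positivity)
  set S' := S + δ • (1 : Matrix (Fin (r i)) (Fin (r i)) ℝ) with hS'
  have hT : (U * S' * Wᵀ)ᵀ = W * S'ᵀ * Uᵀ := by
    rw [Matrix.transpose_mul, Matrix.transpose_mul, Matrix.transpose_transpose, Matrix.mul_assoc]
  have h1 := hε (tenr n i (U * S' * Wᵀ)) (by rw [matr_tenr]; exact rank_usw U W S' hU hW hdet)
    (U * Uᵀ) (W * Wᵀ) (by rw [matr_tenr]; exact isOrthProj U W S' hU hW hdet)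
    (by
      rw [matr_tenr, hT]
      exact isOrthProj W U S'ᵀ hW hU (by rwa [Matrix.det_transpose]))
  have h2 := mfrob_add_smul_bound i (compl_symm _ (orth_symm U)) (compl_idem _ (orth_idem U hU))
    (compl_symm _ (orth_symm W)) (compl_idem _ (orth_idem W hW))
    (G (tenr n i (U * S * Wᵀ))) (G (tenr n i (U * S' * Wᵀ)))
  have h3 : tenr n i (U * S * Wᵀ) - tenr n i (U * S' * Wᵀ) = (-δ) • tenr n i (U * Wᵀ) := by
    have : U * S * Wᵀ - U * S' * Wᵀ = (-δ) • (U * Wᵀ) := by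
      rw [hS', Matrix.mul_add, Matrix.add_mul]
      simp
    funext x
    exact congrFun (congrFun this _) _
  have h4 := hL (tenr n i (U * S * Wᵀ)) (tenr n i (U * S' * Wᵀ))
  rw [h3, tfrob_smul, abs_neg] at h4
  have h5 : L * (|δ| * tfrob (tenr n i (U * Wᵀ))) ≤ |δ| * c := by
    rw [hc]
    have := mul_le_mul_of_nonneg_right (le_abs_self L)
      (mul_nonneg (abs_nonneg δ) (tfrob_nonneg (tenr n i (U * Wᵀ))))
    linarith
  have h6 : |δ| * c ≤ η := by
    have : |δ| * (c + 1) < η := by rwa [lt_div_iff₀ (by positivity)] at hδ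
    nlinarith [abs_nonneg δ]
  linarith

/-! ### One mode -/

lemma matr_add {n : Fin D → ℕ} (i : Fin D) (X Y : Tensor n) :
    matr n i (X + Y) = matr n i X + matr n i Y := rfl

lemma matr_sub {n : Fin D → ℕ} (i : Fin D) (X Y : Tensor n) :
    matr n i (X - Y) = matr n i X - matr n i Y := rfl

lemma mlprod_sub {n m : Fin D → ℕ} (B : ∀ j, Matrix (Fin (m j)) (Fin (n j)) ℝ)
    (X Y : Tensor n) : mlprod B (X - Y) = mlprod B X - mlprod B Y := by
  funext x
  simp [mlprod, mul_sub, Finset.sum_sub_distrib]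

lemma mfrob_two {n : Fin D → ℕ} (i : Fin D) {P : Matrix (Fin (n i)) (Fin (n i)) ℝ}
    {Q : Matrix (CIdx n i) (CIdx n i) ℝ} (hP : Pᵀ = P) (hP2 : P * P = P) (hQ : Qᵀ = Q)
    (hQ2 : Q * Q = Q) (X : Tensor n) : tfrob (tenr n i (P * matr n i X * Q)) ≤ tfrob X := by
  rw [tfrob_tenr, tfrob_eq_mfrob n i]
  exact (mfrob_mul_proj _ hQ hQ2 _).trans (mfrob_proj_mul _ hP hP2 _)

lemma mode_bound {n r : Fin D → ℕ} (i : Fin D) {F : ℝ → Tensor n → Tensor n} {A : ℝ → Tensor n}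
    {t0 t1 L B ε : ℝ} (h01 : t0 ≤ t1) (hL0 : 0 ≤ L)
    (hL : ∀ t ∈ Icc t0 t1, ∀ Y Y' : Tensor n, tfrob (F t Y - F t Y') ≤ L * tfrob (Y - Y'))
    (hB : ∀ t ∈ Icc t0 t1, ∀ Y : Tensor n, tfrob (F t Y) ≤ B)
    (hA : ∀ t ∈ Icc t0 t1, ∀ idx,
      HasDerivWithinAt (fun s => A s idx) (F t (A t) idx) (Icc t0 t1) t)
    (hε : ∀ t ∈ Icc t0 t1, ∀ Y : Tensor n, (matr n i Y).rank = r i →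
      ∀ (P : Matrix (Fin (n i)) (Fin (n i)) ℝ) (Q : Matrix (CIdx n i) (CIdx n i) ℝ),
        IsOrthProjOnto P (matr n i Y) → IsOrthProjOnto Q (matr n i Y)ᵀ →
        mfrob ((1 - P) * matr n i (F t Y) * (1 - Q)) ≤ ε)
    {U1 U0 : ∀ j, Matrix (Fin (n j)) (Fin (r j)) ℝ} (h1 : ∀ j, (U1 j)ᵀ * U1 j = 1)
    (h0 : ∀ j, (U0 j)ᵀ * U0 j = 1) {Q : Matrix (CIdx r i) (Fin (r i)) ℝ} (hQ : Qᵀ * Q = 1)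
    {K : ℝ → Matrix (Fin (n i)) (Fin (r i)) ℝ} {S : ℝ → Matrix (Fin (r i)) (Fin (r i)) ℝ}
    (hK : ∀ t ∈ Icc t0 t1, ∀ a b, HasDerivWithinAt (fun s => K s a b)
      ((matr n i (F t (tenr n i (K t * (Wm U1 U0 i Q)ᵀ))) * Wm U1 U0 i Q) a b) (Icc t0 t1) t)
    (hKS : K t1 = U1 i * S t0)
    (hS : ∀ t ∈ Icc t0 t1, ∀ a b, HasDerivWithinAt (fun s => S s a b)
      ((-((U1 i)ᵀ * (matr n i (F t (tenr n i (U1 i * S t * (Wm U1 U0 i Q)ᵀ)))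
        * Wm U1 U0 i Q))) a b) (Icc t0 t1) t)
    {Z Z' : Tensor n} (hZ : Z = tenr n i (K t0 * (Wm U1 U0 i Q)ᵀ))
    (hZ' : Z' = tenr n i (U1 i * S t1 * (Wm U1 U0 i Q)ᵀ)) {ρ : ℝ}
    (hρ : tfrob (Z - A t0) + 3 * B * (t1 - t0) ≤ ρ) :
    tfrob (Z' - Z) ≤ 2 * B * (t1 - t0) ∧
    tfrob (Z' - Z - (mlprod (pfam U1 i.1) (A t1 - A t0)
      - mlprod (pfam U1 (i.1 + 1)) (A t1 - A t0))) ≤ (3 * (L * ρ) + ε) * (t1 - t0) := by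
  have hWW := Wm_orth h1 h0 i hQ
  have hrem := remainder_matr U0 h1 i Q (A t1 - A t0)
  set W := Wm U1 U0 i Q with hW
  have hm0 : t0 ∈ Icc t0 t1 := ⟨le_rfl, h01⟩
  have hm1 : t1 ∈ Icc t0 t1 := ⟨h01, le_rfl⟩
  have hB0 : 0 ≤ B := (tfrob_nonneg _).trans (hB t0 hm0 0)
  -- projections
  have hPs := orth_symm (U1 i)
  have hPi := orth_idem (U1 i) (h1 i)
  have hQs := orth_symm W
  have hQi := orth_idem W hWW
  set P := U1 i * (U1 i)ᵀ with hP
  set R := W * Wᵀ with hR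
  -- the curves
  set XK : ℝ → Tensor n := fun t => tenr n i (K t * Wᵀ) with hXK
  set XS : ℝ → Tensor n := fun t => tenr n i (U1 i * S t * Wᵀ) with hXS
  have dK : ∀ t ∈ Icc t0 t1, ∀ x, HasDerivWithinAt (fun s => XK s x)
      (tenr n i ((1 : Matrix (Fin (n i)) (Fin (n i)) ℝ) * matr n i (F t (XK t)) * R) x) (Icc t0 t1) t := by
    intro t ht x
    have := hasDeriv_mul (1 : Matrix (Fin (n i)) (Fin (n i)) ℝ) Wᵀ (hK t ht) (x i)
      (fun j => x j.1)
    simp only [Matrix.one_mul, Matrix.mul_assoc] at this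
    simp only [Matrix.one_mul, hR]
    exact this
  have dS : ∀ t ∈ Icc t0 t1, ∀ x, HasDerivWithinAt (fun s => XS s x)
      ((-tenr n i (P * matr n i (F t (XS t)) * R)) x) (Icc t0 t1) t := by
    intro t ht x
    have := hasDeriv_mul (U1 i) Wᵀ (hS t ht) (x i) (fun j => x j.1)
    have e : U1 i * (-((U1 i)ᵀ * (matr n i (F t (tenr n i (U1 i * S t * Wᵀ))) * W))) * Wᵀ
        = -(P * matr n i (F t (XS t)) * R) := by
      simp only [hP, hR, hXS, Matrix.mul_assoc, Matrix.mul_neg, Matrix.neg_mul]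
    rw [e] at this
    exact this
  have dA : ∀ t ∈ Icc t0 t1, ∀ (M : Matrix (Fin (n i)) (Fin (n i)) ℝ)
      (N : Matrix (CIdx n i) (CIdx n i) ℝ) (x : Idx n), HasDerivWithinAt
      (fun s => tenr n i (M * matr n i (A s) * N) x)
      (tenr n i (M * matr n i (F t (A t)) * N) x) (Icc t0 t1) t := by
    intro t ht M N x
    exact hasDeriv_mul M N (K := fun s => matr n i (A s))
      (fun a b => hA t ht (glue n i a b)) _ _
  have one_s : (1 : Matrix (Fin (n i)) (Fin (n i)) ℝ)ᵀ = 1 := Matrix.transpose_one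
  have one_i : (1 : Matrix (Fin (n i)) (Fin (n i)) ℝ) * 1 = 1 := Matrix.mul_one _
  -- a priori bounds
  have bK : ∀ t ∈ Icc t0 t1, tfrob (XK t - XK t0) ≤ B * (t1 - t0) := by
    intro t ht
    refine (tfrob_mvt (C := B) dK (fun t ht => ?_) ht).trans
      (mul_le_mul_of_nonneg_left (by linarith [ht.2]) hB0)
    exact (mfrob_two i one_s one_i hQs hQi _).trans (hB t ht _)
  have bS : ∀ t ∈ Icc t0 t1, tfrob (XS t - XS t0) ≤ B * (t1 - t0) := by
    intro t ht
    refine (tfrob_mvt (C := B) dS (fun t ht => ?_) ht).trans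
      (mul_le_mul_of_nonneg_left (by linarith [ht.2]) hB0)
    rw [tfrob_neg]
    exact (mfrob_two i hPs hPi hQs hQi _).trans (hB t ht _)
  have bA : ∀ t ∈ Icc t0 t1, tfrob (A t - A t0) ≤ B * (t1 - t0) := by
    intro t ht
    refine (tfrob_mvt (C := B) hA (fun t ht => hB t ht _) ht).trans
      (mul_le_mul_of_nonneg_left (by linarith [ht.2]) hB0)
  have eSK : XS t0 = XK t1 := by simp only [hXS, hXK, hKS]
  have eZ : Z = XK t0 := hZ
  have eZ' : Z' = XS t1 := hZ'
  have hh : 0 ≤ B * (t1 - t0) := mul_nonneg hB0 (by linarith)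
  have cK : ∀ s ∈ Icc t0 t1, ∀ t ∈ Icc t0 t1, tfrob (XK s - A t) ≤ ρ := by
    intro s hs t ht
    have e : XK s - A t = (XK s - XK t0) + (Z - A t0) - (A t - A t0) := by rw [eZ]; abel
    rw [e]
    have := tfrob_sub_le ((XK s - XK t0) + (Z - A t0)) (A t - A t0)
    have := tfrob_add_le (XK s - XK t0) (Z - A t0)
    have := bK s hs
    have := bA t ht
    linarith
  have cS : ∀ t ∈ Icc t0 t1, tfrob (XS t - A t) ≤ ρ := by
    intro t ht
    have e : XS t - A t = (XS t - XS t0) + (XK t1 - XK t0) + (Z - A t0) - (A t - A t0) := by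
      rw [eZ, eSK]; abel
    rw [e]
    have := tfrob_sub_le ((XS t - XS t0) + (XK t1 - XK t0) + (Z - A t0)) (A t - A t0)
    have := tfrob_add_le ((XS t - XS t0) + (XK t1 - XK t0)) (Z - A t0)
    have := tfrob_add_le (XS t - XS t0) (XK t1 - XK t0)
    have := bK t1 hm1
    have := bS t ht
    have := bA t ht
    linarith
  refine ⟨?_, ?_⟩
  · have e : Z' - Z = (XS t1 - XS t0) + (XK t1 - XK t0) := by rw [eZ, eZ', eSK]; abel
    rw [e]
    have := tfrob_add_le (XS t1 - XS t0) (XK t1 - XK t0)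
    have := bK t1 hm1
    have := bS t1 hm1
    linarith
  -- defect of the K-step
  have D1 := tfrob_mvt (C := L * ρ)
    (f := fun t => XK t - tenr n i ((1 : Matrix (Fin (n i)) (Fin (n i)) ℝ) * matr n i (A t) * R))
    (f' := fun t => tenr n i ((1 : Matrix (Fin (n i)) (Fin (n i)) ℝ) * matr n i (F t (XK t)) * R)
      - tenr n i ((1 : Matrix (Fin (n i)) (Fin (n i)) ℝ) * matr n i (F t (A t)) * R))
    (fun t ht x => (dK t ht x).sub (dA t ht 1 R x))
    (fun t ht => by
      have e : tenr n i ((1 : Matrix (Fin (n i)) (Fin (n i)) ℝ) * matr n i (F t (XK t)) * R) - tenr n i ((1 : Matrix (Fin (n i)) (Fin (n i)) ℝ) * matr n i (F t (A t)) * R)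
          = tenr n i ((1 : Matrix (Fin (n i)) (Fin (n i)) ℝ) * matr n i (F t (XK t) - F t (A t)) * R) := by
        rw [matr_sub, Matrix.mul_sub, Matrix.sub_mul]; rfl
      rw [e]
      refine (mfrob_two i one_s one_i hQs hQi _).trans ((hL t ht _ _).trans ?_)
      exact mul_le_mul_of_nonneg_left (cK t ht t ht) hL0) hm1
  have D2 := tfrob_mvt (C := L * ρ)
    (f := fun t => XS t + tenr n i (P * matr n i (A t) * R))
    (f' := fun t => -tenr n i (P * matr n i (F t (XS t)) * R)
      + tenr n i (P * matr n i (F t (A t)) * R))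
    (fun t ht x => (dS t ht x).add (dA t ht P R x))
    (fun t ht => by
      have e : -tenr n i (P * matr n i (F t (XS t)) * R) + tenr n i (P * matr n i (F t (A t)) * R)
          = -tenr n i (P * matr n i (F t (XS t) - F t (A t)) * R) := by
        rw [matr_sub, Matrix.mul_sub, Matrix.sub_mul]
        funext x
        simp only [tenr, Pi.add_apply, Pi.neg_apply, Matrix.sub_apply]
        ring
      rw [e, tfrob_neg]
      refine (mfrob_two i hPs hPi hQs hQi _).trans ((hL t ht _ _).trans ?_)
      exact mul_le_mul_of_nonneg_left (cS t ht) hL0) hm1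
  have D3 := tfrob_mvt (C := ε + L * ρ)
    (f := fun t => tenr n i ((1 - P) * matr n i (A t) * ((1 - R) * kronFam i (pfam U1 i.1))))
    (f' := fun t => tenr n i
      ((1 - P) * matr n i (F t (A t)) * ((1 - R) * kronFam i (pfam U1 i.1))))
    (fun t ht x => dA t ht (1 - P) _ x)
    (fun t ht => by
      rw [tfrob_tenr, ← Matrix.mul_assoc]
      refine (mfrob_mul_proj _ (kron_pfam_symm _ _ _) (kron_pfam_idem h1 _ _) _).trans ?_
      have a1 := mfrob_add_smul_bound i (compl_symm _ hPs) (compl_idem _ hPi)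
        (compl_symm _ hQs) (compl_idem _ hQi) (F t (A t)) (F t (XK t1))
      have a2 := eps_bound i (F t) (hL t ht) (hε t ht) (U1 i) W (S t0) (h1 i) hWW
      rw [← hKS] at a2
      have a3 := hL t ht (A t) (XK t1)
      have a4 : tfrob (A t - XK t1) ≤ ρ := by
        rw [← tfrob_neg, neg_sub]; exact cK t1 hm1 t ht
      have a5 := mul_le_mul_of_nonneg_left a4 hL0
      change mfrob ((1 - P) * matr n i (F t (XK t1)) * (1 - R)) ≤ ε at a2
      linarith) hm1
  have key : Z' - Z - (mlprod (pfam U1 i.1) (A t1 - A t0)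
      - mlprod (pfam U1 (i.1 + 1)) (A t1 - A t0))
    = ((XK t1 - tenr n i ((1 : Matrix (Fin (n i)) (Fin (n i)) ℝ) * matr n i (A t1) * R)) - (XK t0 - tenr n i ((1 : Matrix (Fin (n i)) (Fin (n i)) ℝ) * matr n i (A t0) * R)))
      + ((XS t1 + tenr n i (P * matr n i (A t1) * R))
        - (XS t0 + tenr n i (P * matr n i (A t0) * R)))
      - (tenr n i ((1 - P) * matr n i (A t1) * ((1 - R) * kronFam i (pfam U1 i.1)))
        - tenr n i ((1 - P) * matr n i (A t0) * ((1 - R) * kronFam i (pfam U1 i.1)))) := by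
    apply matr_injective i
    rw [eZ, eZ', eSK]
    simp only [matr_add, matr_sub, matr_tenr]
    have hrem' : matr n i (mlprod (pfam U1 i.1) (A t1 - A t0))
        - matr n i (mlprod (pfam U1 (i.1 + 1)) (A t1 - A t0))
        = (1 - P) * (matr n i (A t1) - matr n i (A t0)) * R
          + (1 - P) * (matr n i (A t1) - matr n i (A t0)) *
            ((1 - R) * kronFam i (pfam U1 i.1)) := by
      rw [← matr_sub i (A t1) (A t0), ← Matrix.mul_assoc _ (1 - R), ← hrem]
      abel
    rw [hrem']
    generalize (1 - R) * kronFam i (pfam U1 i.1) = T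
    simp only [Matrix.mul_sub, Matrix.sub_mul, Matrix.one_mul]
    abel
  rw [key]
  have b1 := tfrob_sub_le
    (((XK t1 - tenr n i ((1 : Matrix (Fin (n i)) (Fin (n i)) ℝ) * matr n i (A t1) * R)) - (XK t0 - tenr n i ((1 : Matrix (Fin (n i)) (Fin (n i)) ℝ) * matr n i (A t0) * R)))
      + ((XS t1 + tenr n i (P * matr n i (A t1) * R))
        - (XS t0 + tenr n i (P * matr n i (A t0) * R))))
    (tenr n i ((1 - P) * matr n i (A t1) * ((1 - R) * kronFam i (pfam U1 i.1)))
        - tenr n i ((1 - P) * matr n i (A t0) * ((1 - R) * kronFam i (pfam U1 i.1))))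
  have b2 := tfrob_add_le
    ((XK t1 - tenr n i ((1 : Matrix (Fin (n i)) (Fin (n i)) ℝ) * matr n i (A t1) * R)) - (XK t0 - tenr n i ((1 : Matrix (Fin (n i)) (Fin (n i)) ℝ) * matr n i (A t0) * R)))
    ((XS t1 + tenr n i (P * matr n i (A t1) * R))
        - (XS t0 + tenr n i (P * matr n i (A t0) * R)))
  refine (b1.trans (add_le_add b2 le_rfl)).trans ?_
  refine (add_le_add (add_le_add D1 D2) D3).trans (le_of_eq ?_)
  ring

/-! ### One step -/

lemma step_bound {d : ℕ} {n r : Fin (d + 1) → ℕ} {F : ℝ → Tensor n → Tensor n} {A : ℝ → Tensor n}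
    {t0 t1 L B ε : ℝ} (h01 : t0 ≤ t1) (hL0 : 0 ≤ L)
    (hL : ∀ t ∈ Icc t0 t1, ∀ Y Y' : Tensor n, tfrob (F t Y - F t Y') ≤ L * tfrob (Y - Y'))
    (hB : ∀ t ∈ Icc t0 t1, ∀ Y : Tensor n, tfrob (F t Y) ≤ B)
    (hA : ∀ t ∈ Icc t0 t1, ∀ idx,
      HasDerivWithinAt (fun s => A s idx) (F t (A t) idx) (Icc t0 t1) t)
    (hε : ∀ i, ∀ t ∈ Icc t0 t1, ∀ Y : Tensor n, (matr n i Y).rank = r i →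
      ∀ (P : Matrix (Fin (n i)) (Fin (n i)) ℝ) (Q : Matrix (CIdx n i) (CIdx n i) ℝ),
        IsOrthProjOnto P (matr n i Y) → IsOrthProjOnto Q (matr n i Y)ᵀ →
        mfrob ((1 - P) * matr n i (F t Y) * (1 - Q)) ≤ ε)
    {C0 C1 : Tensor r} {U1 U0 : ∀ j, Matrix (Fin (n j)) (Fin (r j)) ℝ}
    (h0 : ∀ j, (U0 j)ᵀ * U0 j = 1) (hstep : NestedStep n r F t0 t1 C0 U0 C1 U1)
    {e ρ : ℝ} (he : tfrob (mlprod U0 C0 - A t0) ≤ e)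
    (hρ : ρ = e + (2 * d + 6) * B * (t1 - t0)) :
    (∀ j, (U1 j)ᵀ * U1 j = 1) ∧
    tfrob (mlprod U1 C1 - A t1)
      ≤ e + ((d + 1) * (3 * (L * ρ) + ε) + L * ρ) * (t1 - t0) := by
  obtain ⟨Ccur, Qm, S0m, Km, Shat, Sm, Lt, hC0, hQR, hK0, hK, hK1, hS0, hS, hC, hL0', hLt, hC1⟩ :=
    hstep
  have h1 : ∀ j, (U1 j)ᵀ * U1 j = 1 := fun j => (hK1 j).2
  refine ⟨h1, ?_⟩
  simp only [lift_K, proj_K] at hK hS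
  simp only [lift_L, proj_L] at hLt
  have hm0 : t0 ∈ Icc t0 t1 := ⟨le_rfl, h01⟩
  have hm1 : t1 ∈ Icc t0 t1 := ⟨h01, le_rfl⟩
  have hB0 : 0 ≤ B := (tfrob_nonneg _).trans (hB t0 hm0 0)
  have hBh : 0 ≤ B * (t1 - t0) := mul_nonneg hB0 (by linarith)
  set Z : Fin (d + 2) → Tensor n := fun k => mlprod (mix U1 U0 k.1) (Ccur k) with hZdef
  set g := A t1 - A t0 with hg
  have hZ0 : Z 0 = mlprod U0 C0 := by
    simp only [hZdef, hC0]
    congr 1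
  have hmode : ∀ i : Fin (d + 1), tfrob (Z i.castSucc - A t0) + 3 * B * (t1 - t0) ≤ ρ →
      tfrob (Z i.succ - Z i.castSucc) ≤ 2 * B * (t1 - t0) ∧
      tfrob (Z i.succ - Z i.castSucc - (mlprod (pfam U1 i.1) g - mlprod (pfam U1 (i.1 + 1)) g))
        ≤ (3 * (L * ρ) + ε) * (t1 - t0) := by
    intro i hi
    refine mode_bound i h01 hL0 hL hB hA (hε i) h1 h0 (hQR i).2 (hK i)
      (by rw [(hK1 i).1, hS0 i]) (hS i) ?_ ?_ hi
    · apply matr_injective i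
      have e1 : mix U1 U0 i.1 i = U0 i := if_neg (lt_irrefl _)
      have e2 : matr r i (Ccur i.castSucc) = S0m i * (Qm i)ᵀ := by
        have := congrArg Matrix.transpose (hQR i).1
        rwa [Matrix.transpose_transpose, Matrix.transpose_mul, Matrix.transpose_transpose] at this
      simp only [hZdef, Fin.val_castSucc]
      rw [matr_mlprod, matr_tenr, e1, e2, hK0 i, Wm, Matrix.transpose_mul]
      simp only [Matrix.mul_assoc]
    · apply matr_injective i
      have e1 : mix U1 U0 (i.1 + 1) i = U1 i := if_pos (Nat.lt_succ_self _)
      have e3 : kronFam i (mix U1 U0 (i.1 + 1)) = kronFam i (mix U1 U0 i.1) := by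
        apply kronFam_congr
        intro j hj
        have : j.1 ≠ i.1 := fun h => hj (Fin.ext h)
        unfold mix
        congr 1
        simp only [eq_iff_iff]
        omega
      simp only [hZdef, Fin.val_succ]
      rw [matr_mlprod, matr_tenr, e1, e3, hC i, matr_tenr, Wm, Matrix.transpose_mul]
      simp only [Matrix.mul_assoc]
  have hind : ∀ k : Fin (d + 2), tfrob (Z k - Z 0) ≤ 2 * (k.1 : ℝ) * (B * (t1 - t0)) ∧
      tfrob (Z k - Z 0 - (g - mlprod (pfam U1 k.1) g))
        ≤ (k.1 : ℝ) * ((3 * (L * ρ) + ε) * (t1 - t0)) := by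
    intro k
    induction k using Fin.induction with
    | zero =>
      have : mlprod (pfam U1 (0 : Fin (d + 2)).1) g = g := by
        apply matr_injective (0 : Fin (d + 1))
        have e : pfam U1 (0 : Fin (d + 2)).1 = fun j => 1 := by
          funext j; exact if_neg (Nat.not_lt_zero _)
        rw [matr_mlprod, e, kronFam_one, Matrix.transpose_one, Matrix.one_mul, Matrix.mul_one]
      rw [this]
      simp [tfrob_zero]
    | succ i ih =>
      obtain ⟨ih1, ih2⟩ := ih
      simp only [Fin.val_castSucc] at ih1 ih2
      have hid : (i.1 : ℝ) ≤ d := by exact_mod_cast Nat.lt_succ_iff.mp i.2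
      have hi : tfrob (Z i.castSucc - A t0) + 3 * B * (t1 - t0) ≤ ρ := by
        have e1 : Z i.castSucc - A t0 = (Z i.castSucc - Z 0) + (mlprod U0 C0 - A t0) := by
          rw [hZ0]; abel
        have e2 := tfrob_add_le (Z i.castSucc - Z 0) (mlprod U0 C0 - A t0)
        rw [← e1] at e2
        have := mul_le_mul_of_nonneg_right hid hBh
        rw [hρ]
        nlinarith
      obtain ⟨m1, m2⟩ := hmode i hi
      simp only [Fin.val_succ, Nat.cast_add, Nat.cast_one]
      constructor
      · have e1 : Z i.succ - Z 0 = (Z i.succ - Z i.castSucc) + (Z i.castSucc - Z 0) := by abel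
        rw [e1]
        refine (tfrob_add_le _ _).trans ?_
        linarith
      · have e1 : Z i.succ - Z 0 - (g - mlprod (pfam U1 (i.1 + 1)) g)
            = (Z i.succ - Z i.castSucc
              - (mlprod (pfam U1 i.1) g - mlprod (pfam U1 (i.1 + 1)) g))
              + (Z i.castSucc - Z 0 - (g - mlprod (pfam U1 i.1) g)) := by abel
        rw [e1]
        refine (tfrob_add_le _ _).trans ?_
        linarith
  obtain ⟨f1, f2⟩ := hind (Fin.last (d + 1))
  simp only [Fin.val_last, Nat.cast_add, Nat.cast_one] at f1 f2
  -- final L-step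
  set XL : ℝ → Tensor n := fun t => mlprod U1 (tenr r (Fin.last d) (Lt t)) with hXL
  have dL : ∀ t ∈ Icc t0 t1, ∀ x, HasDerivWithinAt (fun s => XL s x)
      (mlprod (pfam U1 (d + 1)) (F t (XL t)) x) (Icc t0 t1) t := by
    intro t ht x
    have e1 : mlprod (pfam U1 (d + 1)) (F t (XL t))
        = mlprod U1 (mlprod (fun j => (U1 j)ᵀ) (F t (XL t))) := by
      rw [mlprod_mlprod _ _ (Fin.last d)]
      congr 1
      funext j
      exact if_pos j.2
    rw [e1]
    refine hasDeriv_mlprod U1 (fun a => ?_) x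
    have := hLt t ht (a (Fin.last d)) (fun j => a j.1)
    have e2 := congrFun (tenr_matr r (Fin.last d) (mlprod (fun j => (U1 j)ᵀ) (F t (XL t)))) a
    rw [← e2]
    exact this
  have eL0 : XL t0 = Z (Fin.last (d + 1)) := by
    simp only [hXL, hL0', tenr_matr, hZdef, Fin.val_last]
    congr 1
    funext j
    exact (if_pos j.2).symm
  have eL1 : mlprod U1 C1 = XL t1 := by rw [hC1]
  have bA : ∀ t ∈ Icc t0 t1, tfrob (A t - A t0) ≤ B * (t1 - t0) := by
    intro t ht
    refine (tfrob_mvt (C := B) hA (fun t ht => hB t ht _) ht).trans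
      (mul_le_mul_of_nonneg_left (by linarith [ht.2]) hB0)
  have bL : ∀ t ∈ Icc t0 t1, tfrob (XL t - XL t0) ≤ B * (t1 - t0) := by
    intro t ht
    refine (tfrob_mvt (C := B) dL (fun t ht => ?_) ht).trans
      (mul_le_mul_of_nonneg_left (by linarith [ht.2]) hB0)
    exact (mlprod_pfam_le h1 _ (Fin.last d) _).trans (hB t ht _)
  have cL : ∀ t ∈ Icc t0 t1, tfrob (XL t - A t) ≤ ρ := by
    intro t ht
    have e1 : XL t - A t = (XL t - XL t0) + (Z (Fin.last (d + 1)) - Z 0)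
        + (mlprod U0 C0 - A t0) - (A t - A t0) := by
      rw [eL0, hZ0]; abel
    rw [e1]
    have := tfrob_sub_le ((XL t - XL t0) + (Z (Fin.last (d + 1)) - Z 0)
        + (mlprod U0 C0 - A t0)) (A t - A t0)
    have := tfrob_add_le ((XL t - XL t0) + (Z (Fin.last (d + 1)) - Z 0)) (mlprod U0 C0 - A t0)
    have := tfrob_add_le (XL t - XL t0) (Z (Fin.last (d + 1)) - Z 0)
    have := bL t ht
    have := bA t ht
    rw [hρ]
    nlinarith
  have D4 := tfrob_mvt (C := L * ρ)
    (f := fun t => XL t - mlprod (pfam U1 (d + 1)) (A t))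
    (f' := fun t => mlprod (pfam U1 (d + 1)) (F t (XL t))
      - mlprod (pfam U1 (d + 1)) (F t (A t)))
    (fun t ht x => (dL t ht x).sub (hasDeriv_mlprod _ (hA t ht) x))
    (fun t ht => by
      rw [← mlprod_sub]
      refine (mlprod_pfam_le h1 _ (Fin.last d) _).trans ((hL t ht _ _).trans ?_)
      exact mul_le_mul_of_nonneg_left (cL t ht) hL0) hm1
  have key : mlprod U1 C1 - A t1 = (mlprod U0 C0 - A t0)
      + (Z (Fin.last (d + 1)) - Z 0 - (g - mlprod (pfam U1 (d + 1)) g))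
      + ((XL t1 - mlprod (pfam U1 (d + 1)) (A t1)) - (XL t0 - mlprod (pfam U1 (d + 1)) (A t0))) := by
    rw [eL1, eL0, hZ0, hg, mlprod_sub]
    abel
  rw [key]
  refine (tfrob_add_le _ _).trans ?_
  have := tfrob_add_le (mlprod U0 C0 - A t0)
    (Z (Fin.last (d + 1)) - Z 0 - (g - mlprod (pfam U1 (d + 1)) g))
  have D4' : tfrob ((XL t1 - mlprod (pfam U1 (d + 1)) (A t1))
    - (XL t0 - mlprod (pfam U1 (d + 1)) (A t0))) ≤ L * ρ * (t1 - t0) := D4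
  linarith

/-- **Robustness of the nested Tucker integrator to small singular values.**
If `F` is `L`-Lipschitz and bounded by `B` in the Frobenius norm, the initial value
`A(t0)` has multilinear rank `(r_1, …, r_d)`, and for every mode `i` the non-tangential
part (with respect to the manifold `M_i` of tensors whose `i`-mode matricization has
rank `r_i`) of `F` is bounded by `ε`, then the iterates `Yₙ` of the nested Tucker
integrator with step size `h` satisfy `‖Yₙ - A(tₙ)‖ ≤ c₁ h + c₂ ε`, with constants
depending only on `L`, `B`, `T - t0` and the dimension `d` — in particular, independent
of singular values of matricizations of the exact or approximate solution. -/
theorem nested_tucker_integrator_robustness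
    (L B Δ : ℝ) (d : ℕ) :
    ∃ c1 c2 : ℝ, ∀ (t0 T : ℝ), T - t0 = Δ →
    ∀ (n r : Fin (d + 1) → ℕ)
      (F : ℝ → Tensor n → Tensor n) (A : ℝ → Tensor n),
    -- continuity in time, Lipschitz continuity and boundedness of `F`
    (∀ (Y : Tensor n) idx, ContinuousOn (fun t => F t Y idx) (Icc t0 T)) →
    (∀ t ∈ Icc t0 T, ∀ Y Y' : Tensor n, tfrob (F t Y - F t Y') ≤ L * tfrob (Y - Y')) →
    (∀ t ∈ Icc t0 T, ∀ Y : Tensor n, tfrob (F t Y) ≤ B) →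
    -- `A` solves `Ȧ(t) = F(t, A(t))` on `[t0, T]`
    (∀ t ∈ Icc t0 T, ∀ idx,
      HasDerivWithinAt (fun s => A s idx) (F t (A t) idx) (Icc t0 T) t) →
    -- the initial value has multilinear rank `(r_1, …, r_d)`
    (∀ i, (matr n i (A t0)).rank = r i) →
    ∀ ε : ℝ, 0 ≤ ε →
    -- the non-tangential part of `F` with respect to each `M_i` is bounded by `ε`
    (∀ (i : Fin (d + 1)), ∀ t ∈ Icc t0 T, ∀ Y : Tensor n, (matr n i Y).rank = r i →
      ∀ (P : Matrix (Fin (n i)) (Fin (n i)) ℝ) (Q : Matrix (CIdx n i) (CIdx n i) ℝ),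
        IsOrthProjOnto P (matr n i Y) → IsOrthProjOnto Q (matr n i Y)ᵀ →
        mfrob ((1 - P) * matr n i (F t Y) * (1 - Q)) ≤ ε) →
    ∀ h : ℝ, 0 < h →
    ∀ (Cs : ℕ → Tensor r) (Us : ℕ → ∀ j, Matrix (Fin (n j)) (Fin (r j)) ℝ),
    -- start from `Y₀ = A(t0)` given in Tucker form
    mlprod (Us 0) (Cs 0) = A t0 → (∀ j, (Us 0 j)ᵀ * Us 0 j = 1) →
    -- the iterates are produced by the nested Tucker integrator
    (∀ k : ℕ, t0 + (k + 1 : ℕ) * h ≤ T →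
      NestedStep n r F (t0 + k * h) (t0 + (k + 1 : ℕ) * h)
        (Cs k) (Us k) (Cs (k + 1)) (Us (k + 1))) →
    ∀ N : ℕ, t0 + N * h ≤ T →
      tfrob (mlprod (Us N) (Cs N) - A (t0 + N * h)) ≤ c1 * h + c2 * ε := by
  have ha0 : (0 : ℝ) ≤ (3 * d + 4) * |L| := by positivity
  obtain ⟨a, ha⟩ : ∃ a : ℝ, a = (3 * d + 4) * |L| := ⟨_, rfl⟩
  rw [← ha] at ha0
  obtain ⟨b, hb⟩ : ∃ b : ℝ, b = a * ((2 * d + 6) * |B|) := ⟨_, rfl⟩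
  have hb0 : 0 ≤ b := by rw [hb]; positivity
  refine ⟨Δ * Real.exp (a * Δ) * b, Δ * Real.exp (a * Δ) * (d + 1), ?_⟩
  intro t0 T hT n r F A _ hL hB hA _ ε hε0 hε h hh Cs Us hY0 hU0 hstep
  -- main induction
  have main : ∀ N : ℕ, t0 + N * h ≤ T → (∀ j, (Us N j)ᵀ * Us N j = 1) ∧
      tfrob (mlprod (Us N) (Cs N) - A (t0 + N * h))
        ≤ N * h * Real.exp (a * (N * h)) * (b * h + (d + 1) * ε) := by
    intro N
    induction N with
    | zero =>
      intro _
      refine ⟨hU0, ?_⟩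
      simp [hY0, tfrob_zero]
    | succ k ih =>
      intro hk
      have hk' : t0 + k * h ≤ T := by push_cast at hk; linarith
      obtain ⟨hU, hE⟩ := ih hk'
      have hkh : 0 ≤ (k : ℝ) * h := by positivity
      have hdiff : t0 + ((k + 1 : ℕ) : ℝ) * h - (t0 + k * h) = h := by push_cast; ring
      have hle : t0 + k * h ≤ t0 + ((k + 1 : ℕ) : ℝ) * h := by linarith
      have hsub : Icc (t0 + k * h) (t0 + ((k + 1 : ℕ) : ℝ) * h) ⊆ Icc t0 T :=
        Icc_subset_Icc (by linarith) hk
      obtain ⟨hU', hE'⟩ := step_bound (L := |L|) (B := |B|) (A := A) (ε := ε) hle (abs_nonneg L)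
        (fun t ht Y Y' => (hL t (hsub ht) Y Y').trans
          (mul_le_mul_of_nonneg_right (le_abs_self L) (tfrob_nonneg _)))
        (fun t ht Y => (hB t (hsub ht) Y).trans (le_abs_self B))
        (fun t ht x => (hA t (hsub ht) x).mono hsub)
        (fun i t ht => hε i t (hsub ht)) hU (hstep k hk) hE rfl
      refine ⟨hU', hE'.trans ?_⟩
      rw [hdiff]
      obtain ⟨c, hc⟩ : ∃ c : ℝ, c = b * h + (d + 1) * ε := ⟨_, rfl⟩
      have hc0 : 0 ≤ c := by rw [hc]; positivity
      obtain ⟨E, hEd⟩ : ∃ E : ℝ, E = k * h * Real.exp (a * (k * h)) * c := ⟨_, rfl⟩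
      rw [← hc, ← hEd]
      have e1 : E + ((d + 1) * (3 * (|L| * (E + (2 * d + 6) * |B| * h)) + ε)
          + |L| * (E + (2 * d + 6) * |B| * h)) * h = E * (1 + a * h) + h * c := by
        rw [hc, hb, ha]; ring
      rw [e1]
      have e2 : 1 + a * h ≤ Real.exp (a * h) := by
        have := Real.add_one_le_exp (a * h); linarith
      have e3 : (1 : ℝ) ≤ Real.exp (a * (((k + 1 : ℕ) : ℝ) * h)) :=
        Real.one_le_exp (by positivity)
      have e4 : Real.exp (a * (((k + 1 : ℕ) : ℝ) * h))
          = Real.exp (a * (k * h)) * Real.exp (a * h) := by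
        rw [← Real.exp_add]; congr 1; push_cast; ring
      have hE0 : 0 ≤ E := by rw [hEd]; positivity
      have e5 : E * (1 + a * h) ≤ k * h * Real.exp (a * (((k + 1 : ℕ) : ℝ) * h)) * c := by
        refine (mul_le_mul_of_nonneg_left e2 hE0).trans (le_of_eq ?_)
        rw [hEd, e4]; ring
      have e6 : h * c ≤ h * c * Real.exp (a * (((k + 1 : ℕ) : ℝ) * h)) :=
        le_mul_of_one_le_right (by positivity) e3
      refine (add_le_add e5 e6).trans (le_of_eq ?_)
      push_cast; ring
  intro N hN
  refine (main N hN).2.trans ?_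
  have hNΔ : (N : ℝ) * h ≤ Δ := by linarith
  have hN0 : 0 ≤ (N : ℝ) * h := by positivity
  have hc0 : 0 ≤ b * h + (d + 1) * ε := by positivity
  calc (N : ℝ) * h * Real.exp (a * (N * h)) * (b * h + (d + 1) * ε)
      ≤ Δ * Real.exp (a * Δ) * (b * h + (d + 1) * ε) := by
        refine mul_le_mul_of_nonneg_right ?_ hc0
        refine mul_le_mul hNΔ ?_ (Real.exp_nonneg _) (hN0.trans hNΔ)
        exact Real.exp_le_exp.2 (mul_le_mul_of_nonneg_left hNΔ ha0)
    _ = _ := by ring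

end TuckerPaper
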